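/- Let χ = 0 and λ ∈ F_p. Then Ext(V_0(λ), K), taken in the category of restricted W-modules (U_0(W)-modules), is isomorphic to K if λ ∈ {p-1, p-2}, and is 0 otherwise. Here K denotes the one-dimensional trivial W-module. -/

import Mathlib

/-!
Common setup: the Witt algebra `W` over `K` (char `p > 3`) has basis
`e_{-1}, e_0, ..., e_{p-2}` with `[e_i, e_j] = (j-i) e_{i+j}` (and `e_k = 0`
outside the range), and `p`-mapping `e_i^{[p]} = δ_{i0} e_i`.  A module with
`p`-character `χ` over `W` (resp. the subalgebra `W_0 = <e_0, ..., e_{p-2}>`)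
is given by a family of endomorphisms `ρ k` (`k : ℤ`, vanishing outside
`[lo, p-2]` where `lo = -1` for `W` and `lo = 0` for `W_0`) satisfying the
bracket relations and `(ρ i)^p - δ_{i0} ρ i = χ(e_i)^p • 1`.

The Baer Ext space `Ext(N, M)` of two such modules, in the category of
modules with `p`-character `χ`, is realized concretely: an extension
`0 → M → E → N → 0` admits a linear splitting `E ≃ M ⊕ N`, under which the
action of `e_k` is `(m, n) ↦ (ρM k m + c k n, ρN k n)` for a "cocycle"
`c : ℤ → (N →ₗ M)`; the conditions for `E` to be a module with `p`-character
`χ` are the cocycle conditions below, Baer equivalence corresponds to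
differing by a coboundary, and the Baer sum / scalar action correspond to the
linear structure on cocycles.  So `Ext(N, M) ≅ cocycles / coboundaries`.
-/

set_option maxHeartbeats 1000000
set_option synthInstance.maxHeartbeats 1000000

noncomputable section

/-- The coefficient `(-1)^j · (i!/(i-j)!) · ((j+1)λ - i + j)` of the action
`e_j · v_i = (coefficient) · v_{i-j}` on the reduced Verma module; it vanishes
for `j > i` since then `Nat.descFactorial i j = 0`. -/
def wCoef (K : Type) [Field K] (lam : K) (j i : ℕ) : K :=
  (-1 : K) ^ j * (Nat.descFactorial i j : K) * (((j : K) + 1) * lam - (i : K) + (j : K))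

/-- Matrices (in the basis `v_0, ..., v_{p-1}`) of the generators `e_j`
(`j : ℤ`) acting on the reduced Verma module `V_χ(λ)`; here `c = χ(e_{-1})^p`.
`e_{-1} v_i = v_{i+1}` for `i < p-1`, `e_{-1} v_{p-1} = c v_0`, and for
`0 ≤ j ≤ p-2`, `e_j v_i = (-1)^j (i!/(i-j)!) ((j+1)λ - i + j) v_{i-j}`. -/
def vermaMat (K : Type) [Field K] (p : ℕ) (c lam : K) : ℤ → Matrix (Fin p) (Fin p) K :=
  fun j =>
    if j = -1 then
      Matrix.of fun k l =>
        if (k : ℕ) = (l : ℕ) + 1 then 1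
        else if (k : ℕ) = 0 ∧ (l : ℕ) = p - 1 then c else 0
    else if 0 ≤ j ∧ j ≤ (p : ℤ) - 2 then
      Matrix.of fun k l =>
        if (l : ℕ) = (k : ℕ) + j.toNat then wCoef K lam j.toNat (l : ℕ) else 0
    else 0

/-- The action of the basis elements `e_j` (`j : ℤ`) on the reduced Verma
module `V_χ(λ)`, with `c = χ(e_{-1})^p`. -/
def vermaRho (K : Type) [Field K] (p : ℕ) (c lam : K) : ℤ → Module.End K (Fin p → K) :=
  fun j => Matrix.toLin' (vermaMat K p c lam j)

/-- The one-dimensional `W_0`-module `K_λ`: `e_0` acts by `λ`, all other `e_j` act by `0`. -/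
def oneDimRho (K : Type) [Field K] (lam : K) : ℤ → Module.End K K :=
  fun j => if j = 0 then lam • (1 : Module.End K K) else 0

/-- The one-dimensional trivial module: every basis element acts by `0`. -/
def trivRho (K : Type) [Field K] : ℤ → Module.End K K := fun _ => 0

/-- The coefficient `(-1)^(j+1) · ((i+1)!/(i-j)!)` of the action
`e_j · u_i = (coefficient) · u_{i-j}` on the `(p-1)`-dimensional simple module `S`. -/
def sCoef (K : Type) [Field K] (j i : ℕ) : K :=
  (-1 : K) ^ (j + 1) * (Nat.descFactorial (i + 1) (j + 1) : K)

/-- Matrices (in the basis `u_0, ..., u_{p-2}`) of the generators `e_j` acting on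
the `(p-1)`-dimensional simple restricted module `S = V_0(p-1)/Soc(V_0(p-1))`. -/
def sMat (K : Type) [Field K] (p : ℕ) : ℤ → Matrix (Fin (p - 1)) (Fin (p - 1)) K :=
  fun j =>
    if j = -1 then
      Matrix.of fun k l => if (k : ℕ) = (l : ℕ) + 1 then 1 else 0
    else if 0 ≤ j ∧ j ≤ (p : ℤ) - 2 then
      Matrix.of fun k l =>
        if (l : ℕ) = (k : ℕ) + j.toNat then sCoef K j.toNat (l : ℕ) else 0
    else 0

/-- The action of the basis elements `e_j` on the simple module `S`. -/
def sRho (K : Type) [Field K] (p : ℕ) : ℤ → Module.End K (Fin (p - 1) → K) :=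
  fun j => Matrix.toLin' (sMat K p j)

section ExtSpace

variable (K : Type) [Field K] (M N : Type) [AddCommGroup M] [Module K M]
  [AddCommGroup N] [Module K N]

/-- Constraint: a cocycle vanishes outside the index range `[lo, p-2]`. -/
def suppConstraint (p : ℕ) (lo k : ℤ) : (ℤ → N →ₗ[K] M) →ₗ[K] (N →ₗ[K] M) :=
  if k < lo ∨ (p : ℤ) - 2 < k then LinearMap.proj k else 0

variable {M N}

/-- Constraint on a cocycle coming from the bracket relation
`[e_i, e_j] = (j - i) e_{i+j}`:
`(j-i) c(i+j) = ρM i ∘ c j + c i ∘ ρN j - ρM j ∘ c i - c j ∘ ρN i`. -/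
def bracketConstraint (p : ℕ) (lo : ℤ) (ρM : ℤ → Module.End K M)
    (ρN : ℤ → Module.End K N) (i j : ℤ) :
    (ℤ → N →ₗ[K] M) →ₗ[K] (N →ₗ[K] M) :=
  if lo ≤ i ∧ i ≤ (p : ℤ) - 2 ∧ lo ≤ j ∧ j ≤ (p : ℤ) - 2 then
    ((j - i : ℤ) : K) • LinearMap.proj (i + j)
      - LinearMap.llcomp K N M M (ρM i) ∘ₗ LinearMap.proj j
      - LinearMap.lcomp K M (ρN j) ∘ₗ LinearMap.proj i
      + LinearMap.llcomp K N M M (ρM j) ∘ₗ LinearMap.proj i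
      + LinearMap.lcomp K M (ρN i) ∘ₗ LinearMap.proj j
  else 0

/-- Constraint on a cocycle expressing that the extension has `p`-character `χ`:
on the extension `E = M ⊕ N` the `(N → M)`-component of `(e_i)^p` is
`∑_{k<p} (ρM i)^k ∘ c i ∘ (ρN i)^(p-1-k)`, and this must agree with the
`(N → M)`-component of `e_i^{[p]} + χ(e_i)^p • 1`, which is `δ_{i0} c i`
(the scalar `χ(e_i)^p` contributes nothing off the diagonal, and the diagonal
blocks hold since `M`, `N` have `p`-character `χ`). -/
def pcharConstraint (p : ℕ) (lo : ℤ) (ρM : ℤ → Module.End K M)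
    (ρN : ℤ → Module.End K N) (i : ℤ) :
    (ℤ → N →ₗ[K] M) →ₗ[K] (N →ₗ[K] M) :=
  if lo ≤ i ∧ i ≤ (p : ℤ) - 2 then
    (∑ k ∈ Finset.range p,
        LinearMap.llcomp K N M M ((ρM i) ^ k) ∘ₗ
          LinearMap.lcomp K M ((ρN i) ^ (p - 1 - k)) ∘ₗ LinearMap.proj i)
      - (if i = 0 then (LinearMap.proj 0 : (ℤ → N →ₗ[K] M) →ₗ[K] (N →ₗ[K] M)) else 0)
  else 0

/-- The space of cocycles: families `c : ℤ → (N →ₗ M)` (the values of a linear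
map `W → Hom(N, M)` on the basis, `lo = -1` for `W` and `lo = 0` for `W_0`)
such that `M ⊕ N` with action `e_k (m, n) = (ρM k m + c k n, ρN k n)` is a
module with `p`-character `χ`. -/
def cocycles (p : ℕ) (lo : ℤ) (ρM : ℤ → Module.End K M) (ρN : ℤ → Module.End K N) :
    Submodule K (ℤ → N →ₗ[K] M) :=
  (⨅ k : ℤ, LinearMap.ker (suppConstraint K M N p lo k)) ⊓
    (⨅ i : ℤ, ⨅ j : ℤ, LinearMap.ker (bracketConstraint K p lo ρM ρN i j)) ⊓
    (⨅ i : ℤ, LinearMap.ker (pcharConstraint K p lo ρM ρN i))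

/-- The coboundaries: cocycles of the form `k ↦ ρM k ∘ f - f ∘ ρN k` for a
linear map `f : N → M`; these are exactly the cocycles of split extensions,
and two cocycles give Baer-equivalent extensions iff they differ by a
coboundary. -/
def coboundaries (p : ℕ) (lo : ℤ) (ρM : ℤ → Module.End K M) (ρN : ℤ → Module.End K N) :
    Submodule K (ℤ → N →ₗ[K] M) :=
  LinearMap.range (LinearMap.pi fun k : ℤ =>
    if lo ≤ k ∧ k ≤ (p : ℤ) - 2 then
      LinearMap.llcomp K N M M (ρM k) - LinearMap.lcomp K M (ρN k)
    else 0)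

/-- The Baer Ext space `Ext(N, M)` in the category of modules with
`p`-character `χ` (over `W` if `lo = -1`, over `W_0` if `lo = 0`), realized
as cocycles modulo coboundaries. -/
abbrev extSpace (p : ℕ) (lo : ℤ) (ρM : ℤ → Module.End K M) (ρN : ℤ → Module.End K N) :=
  (cocycles K p lo ρM ρN) ⧸
    (Submodule.comap (cocycles K p lo ρM ρN).subtype (coboundaries K p lo ρM ρN))

end ExtSpace

end

section Coordinates

variable {K : Type} [Field K] {p : ℕ}

/-- The `n`-th coordinate functional on `K^p`, extended by zero to all `n`. -/
def coordOrZero (K : Type) [Field K] (p n : ℕ) : (Fin p → K) →ₗ[K] K :=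
  if h : n < p then LinearMap.proj ⟨n, h⟩ else 0

lemma coordOrZero_of_lt {n : ℕ} (h : n < p) (x : Fin p → K) :
    coordOrZero K p n x = x ⟨n, h⟩ := by
  simp [coordOrZero, h]

lemma coordOrZero_of_le {n : ℕ} (h : p ≤ n) (x : Fin p → K) : coordOrZero K p n x = 0 := by
  simp [coordOrZero, not_lt.mpr h]

lemma vermaRho_natCast_apply (c lam : K) {j : ℕ} (hj : j + 2 ≤ p) (x : Fin p → K) (k : ℕ) :
    coordOrZero K p k (vermaRho K p c lam j x)
      = wCoef K lam j (k + j) * coordOrZero K p (k + j) x := by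
  rcases lt_or_ge k p with hk | hk
  · rw [coordOrZero_of_lt hk]
    have h1 : ¬ ((j : ℤ) = -1) := by omega
    have h2 : (0 : ℤ) ≤ j ∧ (j : ℤ) ≤ (p : ℤ) - 2 := by omega
    simp only [vermaRho, vermaMat, h1, h2, if_false, and_self, if_true, Matrix.toLin'_apply,
      Matrix.mulVec, dotProduct, Matrix.of_apply, Int.toNat_natCast]
    rcases lt_or_ge (k + j) p with hkj | hkj
    · rw [coordOrZero_of_lt hkj, Finset.sum_eq_single ⟨k + j, hkj⟩]
      · simp
      · intro b _ hb
        rw [if_neg (fun h => hb (Fin.ext h)), zero_mul]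
      · simp
    · rw [coordOrZero_of_le hkj, mul_zero]
      refine Finset.sum_eq_zero fun b _ => ?_
      rw [if_neg (by have := b.2; omega), zero_mul]
  · rw [coordOrZero_of_le hk, coordOrZero_of_le (by omega), mul_zero]

lemma vermaRho_neg_one_apply_zero (lam : K) (hp : 0 < p) (x : Fin p → K) :
    coordOrZero K p 0 (vermaRho K p 0 lam (-1) x) = 0 := by
  rw [coordOrZero_of_lt hp]
  simp [vermaRho, vermaMat, Matrix.mulVec, dotProduct]

lemma vermaRho_neg_one_apply_succ (lam : K) {k : ℕ} (hk : k + 1 < p) (x : Fin p → K) :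
    coordOrZero K p (k + 1) (vermaRho K p 0 lam (-1) x) = coordOrZero K p k x := by
  rw [coordOrZero_of_lt hk, coordOrZero_of_lt (by omega : k < p)]
  simp only [vermaRho, vermaMat, if_true, Matrix.toLin'_apply, Matrix.mulVec, dotProduct,
    Matrix.of_apply]
  rw [Finset.sum_eq_single ⟨k, by omega⟩]
  · simp
  · intro b _ hb
    rw [if_neg (fun h => hb (Fin.ext (by simpa using h.symm)))]
    simp
  · simp

lemma ext_coordOrZero {x y : Fin p → K} (h : ∀ n < p, coordOrZero K p n x = coordOrZero K p n y) :
    x = y := by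
  funext i
  simpa [coordOrZero] using h i i.2

/-- The basis vector `v_n` of `K^p`, extended by zero to all `n`. -/
def singleOrZero (K : Type) [Field K] (p n : ℕ) : Fin p → K := fun i => if (i : ℕ) = n then 1 else 0

lemma coordOrZero_singleOrZero {m : ℕ} (hm : m < p) (n : ℕ) :
    coordOrZero K p m (singleOrZero K p n) = if m = n then 1 else 0 := by
  simp [coordOrZero_of_lt hm, singleOrZero]

lemma singleOrZero_of_le {n : ℕ} (h : p ≤ n) : singleOrZero K p n = 0 := by
  funext i
  have := i.2
  simp [singleOrZero, show (i : ℕ) ≠ n by omega]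

lemma ext_singleOrZero {f g : (Fin p → K) →ₗ[K] K}
    (h : ∀ n < p, f (singleOrZero K p n) = g (singleOrZero K p n)) : f = g := by
  refine (Pi.basisFun K (Fin p)).ext fun i => ?_
  have : Pi.basisFun K (Fin p) i = singleOrZero K p i := by
    funext k
    simp [singleOrZero, Pi.single_apply, Fin.ext_iff]
  rw [this]
  exact h i i.2

lemma vermaRho_neg_one_singleOrZero (lam : K) (n : ℕ) :
    vermaRho K p 0 lam (-1) (singleOrZero K p n) = singleOrZero K p (n + 1) := by
  refine ext_coordOrZero fun m hm => ?_
  rw [coordOrZero_singleOrZero hm]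
  cases m with
  | zero => simp [vermaRho_neg_one_apply_zero lam hm]
  | succ m =>
    rw [vermaRho_neg_one_apply_succ lam hm, coordOrZero_singleOrZero (by omega)]
    simp

lemma vermaRho_neg_one_pow_singleOrZero (lam : K) (n m : ℕ) :
    (vermaRho K p 0 lam (-1) ^ m) (singleOrZero K p n) = singleOrZero K p (n + m) := by
  induction m with
  | zero => simp
  | succ m ih => rw [pow_succ', Module.End.mul_apply, ih, vermaRho_neg_one_singleOrZero, add_assoc]

lemma vermaRho_natCast_singleOrZero_of_lt (lam : K) {j n : ℕ} (hj : j + 2 ≤ p) (h : n < j) :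
    vermaRho K p 0 lam j (singleOrZero K p n) = 0 := by
  refine ext_coordOrZero fun m hm => ?_
  rw [vermaRho_natCast_apply _ _ hj, map_zero]
  rcases lt_or_ge (m + j) p with h' | h'
  · rw [coordOrZero_singleOrZero h', if_neg (by omega), mul_zero]
  · rw [coordOrZero_of_le h', mul_zero]

lemma vermaRho_natCast_singleOrZero_add (lam : K) {j n : ℕ} (hj : j + 2 ≤ p) (hn : n + j < p) :
    vermaRho K p 0 lam j (singleOrZero K p (n + j))
      = wCoef K lam j (n + j) • singleOrZero K p n := by
  refine ext_coordOrZero fun m hm => ?_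
  rw [vermaRho_natCast_apply _ _ hj, map_smul, coordOrZero_singleOrZero hm, smul_eq_mul]
  rcases lt_or_ge (m + j) p with h' | h'
  · rw [coordOrZero_singleOrZero h']
    by_cases h : m = n
    · simp [h]
    · simp [h]
  · rw [coordOrZero_of_le h', if_neg (by omega), mul_zero, mul_zero]

lemma wCoef_zero (lam : K) (i : ℕ) : wCoef K lam 0 i = lam - i := by
  simp [wCoef]

lemma cast_descFactorial_succ (i n : ℕ) :
    (Nat.descFactorial i (n + 1) : K) = Nat.descFactorial i n * ((i : K) - n) := by
  rw [Nat.descFactorial_succ]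
  rcases lt_or_ge i n with h | h
  · simp [Nat.descFactorial_of_lt h]
  · push_cast [Nat.cast_sub h]
    ring

lemma wCoef_sub_wCoef_succ (lam : K) (n i : ℕ) :
    wCoef K lam (n + 1) i - wCoef K lam (n + 1) (i + 1) = ((n : K) + 2) * wCoef K lam n i := by
  simp only [wCoef, Nat.succ_descFactorial_succ, Nat.cast_mul, cast_descFactorial_succ]
  push_cast
  ring

/-- The bracket relation `[e_{-1}, e_j] = (j + 1) e_{j-1}` on `v_n` with `n + 1 < p`. -/
lemma vermaRho_neg_one_bracket (lam : K) {j n : ℕ} (hj : j + 2 ≤ p) (hn : n + 1 < p) :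
    vermaRho K p 0 lam (-1) (vermaRho K p 0 lam j (singleOrZero K p n))
      - vermaRho K p 0 lam j (singleOrZero K p (n + 1))
      = ((j : K) + 1) • vermaRho K p 0 lam ((j : ℤ) - 1) (singleOrZero K p n) := by
  cases j with
  | zero =>
    have h1 := vermaRho_natCast_singleOrZero_add lam hj (show n + 0 < p by omega)
    have h2 := vermaRho_natCast_singleOrZero_add lam hj (show n + 1 + 0 < p by omega)
    simp only [add_zero] at h1 h2
    rw [h1, h2, map_smul, vermaRho_neg_one_singleOrZero, ← sub_smul]
    simp only [Nat.cast_zero, zero_sub, vermaRho_neg_one_singleOrZero, wCoef_zero]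
    congr 1
    push_cast
    ring
  | succ j =>
    have e : ((j + 1 : ℕ) : ℤ) - 1 = (j : ℤ) := by push_cast; ring
    rw [e]
    rcases lt_trichotomy n j with h | rfl | h
    · rw [vermaRho_natCast_singleOrZero_of_lt lam hj (by omega),
        vermaRho_natCast_singleOrZero_of_lt lam hj (by omega),
        vermaRho_natCast_singleOrZero_of_lt lam (by omega) h]
      simp
    · have h1 := vermaRho_natCast_singleOrZero_add lam hj (show 0 + (n + 1) < p by omega)
      have h2 := vermaRho_natCast_singleOrZero_add lam (show n + 2 ≤ p by omega)
        (show 0 + n < p by omega)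
      rw [zero_add] at h1 h2
      rw [vermaRho_natCast_singleOrZero_of_lt lam hj (by omega), h1, h2, map_zero, zero_sub,
        smul_smul, ← neg_smul]
      congr 1
      have := wCoef_sub_wCoef_succ lam n n
      have h0 : wCoef K lam (n + 1) n = 0 := by
        simp [wCoef]
      rw [h0, zero_sub] at this
      rw [this]
      push_cast
      ring
    · obtain ⟨a, rfl⟩ : ∃ a, n = a + (j + 1) := ⟨n - (j + 1), by omega⟩
      have h1 := vermaRho_natCast_singleOrZero_add lam hj (show a + (j + 1) < p by omega)
      have h2 := vermaRho_natCast_singleOrZero_add lam hj (show a + 1 + (j + 1) < p by omega)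
      have h3 := vermaRho_natCast_singleOrZero_add lam (show j + 2 ≤ p by omega)
        (show a + 1 + j < p by omega)
      rw [show a + 1 + (j + 1) = a + (j + 1) + 1 by ring] at h2
      rw [show a + 1 + j = a + (j + 1) by ring] at h3
      rw [h1, h2, h3, map_smul, vermaRho_neg_one_singleOrZero, ← sub_smul, smul_smul,
        wCoef_sub_wCoef_succ]
      congr 2
      push_cast
      ring

end Coordinates

section TrivialCoefficients

variable {K : Type} [Field K] {p : ℕ} {N : Type} [AddCommGroup N] [Module K N]

lemma mem_cocycles_trivRho_iff (hp : 0 < p) (lo : ℤ) (ρ : ℤ → Module.End K N)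
    (c : ℤ → N →ₗ[K] K) :
    c ∈ cocycles K p lo (trivRho K) ρ ↔
      (∀ k, k < lo ∨ (p : ℤ) - 2 < k → c k = 0) ∧
      (∀ i j, lo ≤ i → i ≤ (p : ℤ) - 2 → lo ≤ j → j ≤ (p : ℤ) - 2 → ∀ x,
        ((j : K) - i) * c (i + j) x = c i (ρ j x) - c j (ρ i x)) ∧
      (∀ i, lo ≤ i → i ≤ (p : ℤ) - 2 → ∀ x,
        c i ((ρ i ^ (p - 1)) x) = if i = 0 then c 0 x else 0) := by
  simp only [cocycles, Submodule.mem_inf, Submodule.mem_iInf, LinearMap.mem_ker, and_assoc]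
  refine and_congr ?_ (and_congr ?_ ?_)
  · refine forall_congr' fun k => ?_
    unfold suppConstraint
    split_ifs with h <;> simp [h]
  · refine forall_congr' fun i => forall_congr' fun j => ?_
    unfold bracketConstraint
    split_ifs with h
    · obtain ⟨h1, h2, h3, h4⟩ := h
      simp only [h1, h2, h3, h4, forall_true_left, LinearMap.ext_iff]
      refine forall_congr' fun x => ?_
      simp only [trivRho, map_zero, LinearMap.zero_comp, LinearMap.sub_apply, LinearMap.add_apply,
        LinearMap.smul_apply, LinearMap.comp_apply, LinearMap.proj_apply, LinearMap.lcomp_apply,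
        LinearMap.zero_apply, sub_zero, add_zero, smul_eq_mul, Int.cast_sub]
      constructor <;> intro h <;> linear_combination h
    · simp only [true_iff, LinearMap.zero_apply]
      intro h1 h2 h3 h4
      exact absurd ⟨h1, h2, h3, h4⟩ h
  · refine forall_congr' fun i => ?_
    unfold pcharConstraint
    split_ifs with h h'
    · simp only [h.1, h.2, forall_true_left, LinearMap.ext_iff]
      refine forall_congr' fun x => ?_
      rw [Finset.sum_eq_single_of_mem 0 (by simpa using hp)
        (fun k _ hk => by simp [trivRho, zero_pow hk])]
      simp [sub_eq_zero]
    · simp only [h.1, h.2, forall_true_left, LinearMap.ext_iff]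
      refine forall_congr' fun x => ?_
      rw [Finset.sum_eq_single_of_mem 0 (by simpa using hp)
        (fun k _ hk => by simp [trivRho, zero_pow hk])]
      simp
    · simp only [true_iff, LinearMap.zero_apply]
      intro h1 h2
      exact absurd ⟨h1, h2⟩ h
    · simp only [true_iff, LinearMap.zero_apply]
      intro h1 h2
      exact absurd ⟨h1, h2⟩ h

lemma mem_coboundaries_trivRho_iff (lo : ℤ) (ρ : ℤ → Module.End K N) (c : ℤ → N →ₗ[K] K) :
    c ∈ coboundaries K p lo (trivRho K) ρ ↔
      ∃ f : N →ₗ[K] K, ∀ k, c k = if lo ≤ k ∧ k ≤ (p : ℤ) - 2 then -(f ∘ₗ ρ k) else 0 := by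
  simp only [coboundaries, LinearMap.mem_range]
  refine exists_congr fun f => ?_
  rw [funext_iff]
  refine forall_congr' fun k => ?_
  rw [LinearMap.pi_apply, eq_comm]
  split_ifs with h
  · have hk : (LinearMap.llcomp K N K K (trivRho K k) - LinearMap.lcomp K K (ρ k) :
        (N →ₗ[K] K) →ₗ[K] (N →ₗ[K] K)) f = -(f ∘ₗ ρ k) := by
      ext x
      simp [trivRho]
    rw [hk]
  · simp

end TrivialCoefficients

section Cocycles

variable {K : Type} [Field K] {p : ℕ}

lemma natCast_ne_zero_of_lt [CharP K p] {n : ℕ} (h0 : 0 < n) (h : n < p) : (n : K) ≠ 0 := by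
  rw [Ne, CharP.cast_eq_zero_iff K p]
  exact Nat.not_dvd_of_pos_of_lt h0 h

/-- The weight condition on the values of a cocycle at the highest weight vector. -/
lemma cocycle_weight {lam : K} {c : ℤ → (Fin p → K) →ₗ[K] K}
    (hc : c ∈ cocycles K p (-1) (trivRho K) (vermaRho K p 0 lam)) {j : ℕ} (h0 : 0 < j)
    (hj : j + 2 ≤ p) : ((j : K) + lam) * c j (singleOrZero K p 0) = 0 := by
  obtain ⟨-, hb, -⟩ := (mem_cocycles_trivRho_iff (by omega) _ _ _).1 hc
  have h := hb ((0 : ℕ) : ℤ) j (by omega) (by omega) (by omega) (by omega) (singleOrZero K p 0)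
  have h1 := vermaRho_natCast_singleOrZero_add lam (show 0 + 2 ≤ p by omega)
    (show 0 + 0 < p by omega)
  simp only [add_zero] at h1
  rw [h1, vermaRho_natCast_singleOrZero_of_lt lam hj h0, wCoef_zero] at h
  simp only [Nat.cast_zero, zero_add, map_zero, map_smul, smul_eq_mul, Int.cast_natCast,
    Int.cast_zero, sub_zero] at h
  linear_combination h

lemma cocycle_apply_highest_eq_zero [CharP K p] {lam : K} {c : ℤ → (Fin p → K) →ₗ[K] K}
    (hc : c ∈ cocycles K p (-1) (trivRho K) (vermaRho K p 0 lam)) {j : ℕ} (h0 : 2 < j)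
    (hj : j + 2 ≤ p) : c j (singleOrZero K p 0) = 0 := by
  obtain ⟨-, hb, -⟩ := (mem_cocycles_trivRho_iff (by omega) _ _ _).1 hc
  obtain ⟨a, rfl⟩ : ∃ a, j = 1 + (a + 2) := ⟨j - 3, by omega⟩
  have h := hb ((1 : ℕ) : ℤ) ((a + 2 : ℕ) : ℤ) (by omega) (by omega) (by omega) (by omega)
    (singleOrZero K p 0)
  rw [vermaRho_natCast_singleOrZero_of_lt lam (by omega) (by omega),
    vermaRho_natCast_singleOrZero_of_lt lam (by omega) (by omega), map_zero, map_zero, sub_zero,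
    ← Nat.cast_add] at h
  have h' : ((a + 1 : ℕ) : K) * c ((1 + (a + 2) : ℕ) : ℤ) (singleOrZero K p 0) = 0 := by
    rw [← h]
    push_cast
    ring
  exact (mul_eq_zero.1 h').resolve_left (natCast_ne_zero_of_lt (by omega) (by omega))

/-- The functional on `K^p` with prescribed values on the basis. -/
def functionalOfValues (a : ℕ → K) : (Fin p → K) →ₗ[K] K :=
  ∑ i : Fin p, a i • LinearMap.proj i

lemma functionalOfValues_singleOrZero (a : ℕ → K) {n : ℕ} (hn : n < p) :
    functionalOfValues a (singleOrZero K p n) = a n := by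
  simp only [functionalOfValues, LinearMap.sum_apply, LinearMap.smul_apply, LinearMap.proj_apply,
    singleOrZero, smul_eq_mul, mul_ite, mul_one, mul_zero]
  rw [Finset.sum_eq_single ⟨n, hn⟩]
  · simp
  · intro b _ hb
    rw [if_neg (fun h => hb (Fin.ext h))]
  · simp

lemma mem_coboundaries_of_highest_eq_zero [CharP K p] (hp : 3 < p) {lam : K}
    {c : ℤ → (Fin p → K) →ₗ[K] K}
    (hc : c ∈ cocycles K p (-1) (trivRho K) (vermaRho K p 0 lam))
    (h1 : c 1 (singleOrZero K p 0) = 0) (h2 : c 2 (singleOrZero K p 0) = 0) :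
    c ∈ coboundaries K p (-1) (trivRho K) (vermaRho K p 0 lam) := by
  obtain ⟨hs, hb, hr⟩ := (mem_cocycles_trivRho_iff (by omega) _ _ _).1 hc
  have hpos : ∀ j : ℕ, 0 < j → j + 2 ≤ p → c j (singleOrZero K p 0) = 0 := by
    intro j hj hjp
    rcases (by omega : j = 1 ∨ j = 2 ∨ 2 < j) with rfl | rfl | h
    · exact h1
    · exact h2
    · exact cocycle_apply_highest_eq_zero hc h hjp
  have hρ0 := vermaRho_natCast_singleOrZero_add lam (show 0 + 2 ≤ p by omega)
    (show 0 + 0 < p by omega)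
  simp only [add_zero, wCoef_zero, Nat.cast_zero, sub_zero] at hρ0
  have hc0 : lam = 0 → c 0 (singleOrZero K p 0) = 0 := by
    intro hl
    have h := hr 0 (by omega) (by omega) (singleOrZero K p 0)
    obtain ⟨q, hq⟩ : ∃ q, p - 1 = q + 1 := ⟨p - 2, by omega⟩
    rw [hq, pow_succ, Module.End.mul_apply, hρ0, hl] at h
    simpa using h.symm
  set f : (Fin p → K) →ₗ[K] K := functionalOfValues fun n =>
    if n = 0 then -(c 0 (singleOrZero K p 0) / lam) else -(c (-1) (singleOrZero K p (n - 1)))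
    with hf
  have hf0 : f (singleOrZero K p 0) = -(c 0 (singleOrZero K p 0) / lam) := by
    rw [hf, functionalOfValues_singleOrZero _ (by omega), if_pos rfl]
  have hneg : ∀ x, c (-1) x = -f (vermaRho K p 0 lam (-1) x) := by
    have : c (-1) = -(f ∘ₗ vermaRho K p 0 lam (-1)) := by
      refine ext_singleOrZero fun n hn => ?_
      rw [LinearMap.neg_apply, LinearMap.comp_apply, vermaRho_neg_one_singleOrZero]
      rcases Nat.lt_or_ge (n + 1) p with h | h
      · rw [hf, functionalOfValues_singleOrZero _ h]
        simp
      · rw [singleOrZero_of_le h, map_zero, neg_zero]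
        have h' := hr (-1) (by omega) (by omega) (singleOrZero K p 0)
        rw [vermaRho_neg_one_pow_singleOrZero, if_neg (by omega)] at h'
        rwa [show n = 0 + (p - 1) by omega]
    intro x
    rw [this]
    rfl
  have key : ∀ n, n < p → ∀ j : ℕ, j + 2 ≤ p →
      c j (singleOrZero K p n) = -f (vermaRho K p 0 lam j (singleOrZero K p n)) := by
    intro n
    induction n with
    | zero =>
      intro _ j hj
      rcases Nat.eq_zero_or_pos j with rfl | h
      · rw [Nat.cast_zero, hρ0, map_smul, hf0, smul_eq_mul]
        by_cases hl : lam = 0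
        · rw [hc0 hl, hl]
          simp
        · field_simp
      · rw [hpos j h hj, vermaRho_natCast_singleOrZero_of_lt lam hj h, map_zero, neg_zero]
    | succ n ih =>
      intro hn j hj
      have hprev : c ((j : ℤ) - 1) (singleOrZero K p n)
          = -f (vermaRho K p 0 lam ((j : ℤ) - 1) (singleOrZero K p n)) := by
        cases j with
        | zero => simpa using hneg _
        | succ j =>
          rw [show ((j + 1 : ℕ) : ℤ) - 1 = (j : ℤ) by push_cast; ring]
          exact ih (by omega) j (by omega)
      have h := hb (-1) j (by omega) (by omega) (by omega) (by omega) (singleOrZero K p n)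
      rw [vermaRho_neg_one_singleOrZero, hneg, show (-1 : ℤ) + j = (j : ℤ) - 1 by ring,
        hprev] at h
      have h' := congrArg f (vermaRho_neg_one_bracket lam hj hn)
      simp only [map_sub, map_smul, smul_eq_mul] at h'
      push_cast at h
      linear_combination h - h'
  rw [mem_coboundaries_trivRho_iff]
  refine ⟨f, fun k => ?_⟩
  split_ifs with hk
  · rcases (by omega : k = -1 ∨ 0 ≤ k) with rfl | h0
    · exact LinearMap.ext hneg
    · lift k to ℕ using h0
      exact ext_singleOrZero fun n hn => key n hn k (by omega)
  · exact hs k (by omega)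

/-- The cocycle of weight `d`, spanning `Ext(V_0(-d), K)` for `d = 1, 2`. -/
def weightCocycle (K : Type) [Field K] (p d : ℕ) (j : ℤ) : (Fin p → K) →ₗ[K] K :=
  if (d : ℤ) ≤ j then
    ((-1 : K) ^ j.toNat * ((j.toNat + 1).factorial : K)) • coordOrZero K p (j.toNat - d)
  else 0

lemma weightCocycle_of_lt {d : ℕ} {j : ℤ} (h : j < d) : weightCocycle K p d j = 0 := by
  simp [weightCocycle, not_le.mpr h]

lemma weightCocycle_add (d a : ℕ) (x : Fin p → K) :
    weightCocycle K p d ((a + d : ℕ) : ℤ) x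
      = (-1 : K) ^ (a + d) * ((a + d + 1).factorial : K) * coordOrZero K p a x := by
  rw [weightCocycle, if_pos (by omega), Int.toNat_natCast, Nat.add_sub_cancel]
  rfl

lemma cast_factorial_eq_zero [CharP K p] {n : ℕ} (hp : 0 < p) (h : p ≤ n) :
    (n.factorial : K) = 0 := by
  rw [CharP.cast_eq_zero_iff K p]
  exact Nat.dvd_factorial hp h

lemma weightCocycle_of_gt [CharP K p] {d : ℕ} (hp : 0 < p) {j : ℤ} (h : (p : ℤ) - 2 < j) :
    weightCocycle K p d j = 0 := by
  unfold weightCocycle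
  split_ifs with hd
  · rw [cast_factorial_eq_zero hp (by omega), mul_zero, zero_smul]
  · rfl

lemma weightCocycle_vermaRho_neg_one (lam : K) {d j : ℕ} (hd : 0 < d) (hj : j < p)
    (x : Fin p → K) :
    weightCocycle K p d j (vermaRho K p 0 lam (-1) x)
      = -((j : K) + 1) * weightCocycle K p d ((j : ℤ) - 1) x := by
  rcases lt_trichotomy j d with h | rfl | h
  · rw [weightCocycle_of_lt (by omega), weightCocycle_of_lt (by omega)]
    simp
  · have h1 := weightCocycle_add j 0 (vermaRho K p 0 lam (-1) x)
    rw [zero_add, vermaRho_neg_one_apply_zero lam (by omega), mul_zero] at h1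
    rw [h1, weightCocycle_of_lt (by omega)]
    simp
  · obtain ⟨a, rfl⟩ : ∃ a, j = a + 1 + d := ⟨j - d - 1, by omega⟩
    rw [show ((a + 1 + d : ℕ) : ℤ) - 1 = ((a + d : ℕ) : ℤ) by push_cast; ring,
      weightCocycle_add, weightCocycle_add, vermaRho_neg_one_apply_succ lam (by omega),
      show a + 1 + d + 1 = (a + d + 1) + 1 by ring, Nat.factorial_succ (a + d + 1)]
    push_cast
    ring

lemma weightCocycle_vermaRho_natCast (lam : K) (d a j : ℕ) (hj : j + 2 ≤ p)
    (x : Fin p → K) :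
    weightCocycle K p d ((a + d : ℕ) : ℤ) (vermaRho K p 0 lam j x)
      = (-1 : K) ^ (a + d) * ((a + d + 1).factorial : K) *
        (wCoef K lam j (a + j) * coordOrZero K p (a + j) x) := by
  rw [weightCocycle_add, vermaRho_natCast_apply _ _ hj]

lemma cast_factorial_mul_descFactorial (a j : ℕ) :
    (a.factorial : K) * ((a + j).descFactorial j : K) = ((a + j).factorial : K) := by
  have := Nat.factorial_mul_descFactorial (Nat.le_add_left j a)
  rw [Nat.add_sub_cancel] at this
  rw [← Nat.cast_mul, this]

lemma weightCocycle_bracket_of_le {d : ℕ} (hd : d = 1 ∨ d = 2) {i j : ℕ}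
    (hi : i + 2 ≤ p) (hj : j + 2 ≤ p) (hij : i ≤ j) (x : Fin p → K) :
    ((j : K) - i) * weightCocycle K p d ((i : ℤ) + j) x
      = weightCocycle K p d i (vermaRho K p 0 (-(d : K)) j x)
        - weightCocycle K p d j (vermaRho K p 0 (-(d : K)) i x) := by
  rw [← Nat.cast_add]
  rcases lt_or_ge j d with h | h
  · rw [weightCocycle_of_lt (j := (i : ℤ)) (by omega), weightCocycle_of_lt (j := (j : ℤ)) (by omega)]
    rcases hij.eq_or_lt with rfl | hlt
    · simp
    · rw [weightCocycle_of_lt (by omega)]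
      simp
  obtain ⟨b, rfl⟩ : ∃ b, j = b + d := ⟨j - d, by omega⟩
  rw [show i + (b + d) = (b + i) + d by ring, weightCocycle_add,
    weightCocycle_vermaRho_natCast _ _ _ _ hi]
  rcases lt_or_ge i d with h' | h'
  · rw [weightCocycle_of_lt (j := (i : ℤ)) (by omega)]
    rcases (by omega : i = 0 ∨ i = 1 ∧ d = 2) with rfl | ⟨rfl, rfl⟩
    · simp only [wCoef_zero]
      push_cast
      simp only [add_zero, LinearMap.zero_apply]
      ring
    · simp only [wCoef, Nat.descFactorial_one, LinearMap.zero_apply]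
      rw [show b + 1 + 2 + 1 = (b + 2 + 1) + 1 by ring, Nat.factorial_succ (b + 2 + 1)]
      push_cast
      ring
  · obtain ⟨a, rfl⟩ : ∃ a, i = a + d := ⟨i - d, by omega⟩
    rw [weightCocycle_vermaRho_natCast _ _ _ _ hj]
    have ha := cast_factorial_mul_descFactorial (K := K) a (b + d)
    have hb := cast_factorial_mul_descFactorial (K := K) b (a + d)
    rw [show b + (a + d) = a + (b + d) by ring] at hb ⊢
    simp only [wCoef]
    generalize ((a + (b + d)).descFactorial (b + d) : K) = A at *
    generalize ((a + (b + d)).descFactorial (a + d) : K) = B at *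
    have h2 : ∀ n : ℕ, ((n + 1 + 1).factorial : K) = (n + 2) * (n + 1) * n.factorial := by
      intro n
      simp only [Nat.factorial_succ]
      push_cast
      ring
    have h3 : ∀ n : ℕ, ((n + 2 + 1).factorial : K) = (n + 3) * (n + 2) * (n + 1) * n.factorial := by
      intro n
      simp only [Nat.factorial_succ]
      push_cast
      ring
    rcases hd with rfl | rfl
    · rw [h2, h2, h2, ← sub_eq_zero]
      push_cast
      generalize ((a + (b + 1)).factorial : K) = F at *
      generalize coordOrZero K p (a + (b + 1)) x = X at *
      linear_combination
        (-1 : K) ^ (a + b) * (a + 2) * (a + 1) * (a + b + 2) * X * ha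
        - (-1 : K) ^ (a + b) * (b + 2) * (b + 1) * (a + b + 2) * X * hb
    · rw [h3, h3, h3, ← sub_eq_zero]
      push_cast
      generalize ((a + (b + 2)).factorial : K) = F at *
      generalize coordOrZero K p (a + (b + 2)) x = X at *
      linear_combination
        (-1 : K) ^ (a + b) * (a + 3) * (a + 2) * (a + 1) * (a + 2 * b + 6) * X * ha
        - (-1 : K) ^ (a + b) * (b + 3) * (b + 2) * (b + 1) * (b + 2 * a + 6) * X * hb

lemma weightCocycle_mem_cocycles [CharP K p] (hp : 3 < p) {d : ℕ} (hd : d = 1 ∨ d = 2) :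
    weightCocycle K p d ∈ cocycles K p (-1) (trivRho K) (vermaRho K p 0 (-(d : K))) := by
  rw [mem_cocycles_trivRho_iff (by omega)]
  refine ⟨?_, ?_, ?_⟩
  · rintro k (h | h)
    · exact weightCocycle_of_lt (by omega)
    · exact weightCocycle_of_gt (by omega) h
  · intro i j hi hi' hj hj' x
    rcases (by omega : i = -1 ∨ 0 ≤ i) with rfl | hi0 <;>
    rcases (by omega : j = -1 ∨ 0 ≤ j) with rfl | hj0
    · simp
    · lift j to ℕ using hj0
      rw [weightCocycle_vermaRho_neg_one _ (by omega) (by omega),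
        weightCocycle_of_lt (j := -1) (by omega), show (-1 : ℤ) + j = (j : ℤ) - 1 by ring]
      push_cast
      simp only [LinearMap.zero_apply]
      ring
    · lift i to ℕ using hi0
      rw [weightCocycle_vermaRho_neg_one _ (by omega) (by omega),
        weightCocycle_of_lt (j := -1) (by omega), ← sub_eq_add_neg]
      push_cast
      simp only [LinearMap.zero_apply]
      ring
    · lift i to ℕ using hi0
      lift j to ℕ using hj0
      push_cast
      rcases le_total i j with h | h
      · exact weightCocycle_bracket_of_le hd (by omega) (by omega) h x
      · have := weightCocycle_bracket_of_le hd (by omega) (by omega) h x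
        rw [add_comm (i : ℤ)]
        linear_combination -this
  · intro i hi hi' x
    rcases lt_or_ge i d with h | h
    · rw [weightCocycle_of_lt h, weightCocycle_of_lt (j := 0) (by omega)]
      simp
    · lift i to ℕ using (by omega)
      rw [if_neg (by omega)]
      obtain ⟨a, rfl⟩ : ∃ a, i = a + d := ⟨i - d, by omega⟩
      have hpow : ∀ q, (∀ k y, q ≤ k + (a + d) →
          coordOrZero K p k (vermaRho K p 0 (-(d : K)) ((a + d : ℕ) : ℤ) y) = 0) →
          ∀ n k y, q ≤ k + (a + d) * (n + 1) → coordOrZero K p k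
            ((vermaRho K p 0 (-(d : K)) ((a + d : ℕ) : ℤ) ^ (n + 1)) y) = 0 := by
        intro q hq n
        induction n with
        | zero => simpa using hq
        | succ n ih =>
          intro k y hk
          rw [pow_succ', Module.End.mul_apply, vermaRho_natCast_apply _ _ (by omega),
            ih (k + (a + d)) y (by rw [Nat.mul_succ] at hk; omega), mul_zero]
      obtain ⟨r, rfl⟩ : ∃ r, p = r + 2 := ⟨p - 2, by omega⟩
      rw [weightCocycle_add, show r + 2 - 1 = r + 1 by omega]
      have hgen : ∀ k y, r + 2 ≤ k + (a + d) → coordOrZero K (r + 2) k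
          (vermaRho K (r + 2) 0 (-(d : K)) ((a + d : ℕ) : ℤ) y) = 0 := by
        intro k y hk
        rw [vermaRho_natCast_apply _ _ (by omega), coordOrZero_of_le hk, mul_zero]
      rcases (by omega : a + d = 1 ∨ 2 ≤ a + d) with h1 | h2
      · rw [hpow (r + 1) ?_ r a x (by rw [h1]; omega), mul_zero]
        intro k y hk
        rcases hk.eq_or_lt with hk | hk
        · rw [vermaRho_natCast_apply _ _ (by omega)]
          have hp0 : ((r + 2 : ℕ) : K) = 0 := CharP.cast_eq_zero K (r + 2)
          push_cast at hp0
          obtain rfl : d = 1 := by omega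
          obtain rfl : a = 0 := by omega
          have : wCoef K (-((1 : ℕ) : K)) (0 + 1) (k + (0 + 1)) = 0 := by
            rw [← hk]
            simp only [wCoef, Nat.cast_one, zero_add, Nat.cast_add]
            linear_combination (-(-1 : K) ^ 1 * ((r + 1).descFactorial 1 : K)) * hp0
          rw [this, zero_mul]
        · exact hgen k y (by omega)
      · rw [hpow (r + 2) hgen r a x ?_, mul_zero]
        have := Nat.mul_le_mul_right (r + 1) h2
        omega

lemma weightCocycle_apply_highest (d : ℕ) (hp : 0 < p) :
    weightCocycle K p d d (singleOrZero K p 0) = (-1) ^ d * ((d + 1).factorial : K) := by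
  have := weightCocycle_add (K := K) (p := p) d 0 (singleOrZero K p 0)
  rw [coordOrZero_singleOrZero hp] at this
  simpa using this

lemma finrank_extSpace_of_weight [CharP K p] (hp : 3 < p) {d : ℕ} (hd : d = 1 ∨ d = 2)
    {lam : K} (hlam : lam = -(d : K)) :
    Module.finrank K (extSpace K p (-1) (trivRho K) (vermaRho K p 0 lam)) = 1 := by
  subst hlam
  have hprime : p.Prime := (CharP.char_is_prime_or_zero K p).resolve_right (by omega)
  have hz := weightCocycle_mem_cocycles (K := K) hp hd
  have hne : weightCocycle K p d d (singleOrZero K p 0) ≠ 0 := by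
    rw [weightCocycle_apply_highest d (by omega)]
    refine mul_ne_zero (pow_ne_zero _ (by simp)) ?_
    rw [Ne, CharP.cast_eq_zero_iff K p, hprime.dvd_factorial]
    omega
  refine finrank_eq_one (Submodule.Quotient.mk ⟨_, hz⟩) ?_ ?_
  · rw [Ne, Submodule.Quotient.mk_eq_zero, Submodule.mem_comap, mem_coboundaries_trivRho_iff]
    rintro ⟨f, hf⟩
    apply hne
    have := hf d
    rw [if_pos (by omega)] at this
    simp only [Submodule.coe_subtype] at this
    rw [this, LinearMap.neg_apply, LinearMap.comp_apply,
      vermaRho_natCast_singleOrZero_of_lt _ (by omega) (by omega), map_zero, neg_zero]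
  · intro w
    obtain ⟨⟨c, hc⟩, rfl⟩ := Submodule.Quotient.mk_surjective _ w
    refine ⟨c d (singleOrZero K p 0) / weightCocycle K p d d (singleOrZero K p 0), ?_⟩
    rw [← Submodule.Quotient.mk_smul, eq_comm, Submodule.Quotient.eq, Submodule.mem_comap]
    set t := c d (singleOrZero K p 0) / weightCocycle K p d d (singleOrZero K p 0) with ht
    have hmem : c - t • weightCocycle K p d ∈
        cocycles K p (-1) (trivRho K) (vermaRho K p 0 (-(d : K))) :=
      Submodule.sub_mem _ hc (Submodule.smul_mem _ _ hz)
    have hdd : (c - t • weightCocycle K p d) d (singleOrZero K p 0) = 0 := by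
      simp [ht, hne]
    have hoff : ∀ j : ℕ, 0 < j → j ≤ 2 →
        (c - t • weightCocycle K p d) j (singleOrZero K p 0) = 0 := by
      intro j hj0 hj
      by_cases hjd : j = d
      · rw [hjd, hdd]
      · refine (mul_eq_zero.1 (cocycle_weight hmem hj0 (by omega))).resolve_left ?_
        have h1 : (1 : K) ≠ 0 := one_ne_zero
        rcases (by omega : j = 1 ∧ d = 2 ∨ j = 2 ∧ d = 1) with ⟨rfl, rfl⟩ | ⟨rfl, rfl⟩
        · intro h
          exact h1 (by push_cast at h; linear_combination -h)
        · intro h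
          exact h1 (by push_cast at h; linear_combination h)
    exact mem_coboundaries_of_highest_eq_zero hp hmem (hoff 1 (by omega) (by omega))
      (hoff 2 (by omega) le_rfl)

lemma finrank_extSpace_of_ne [CharP K p] (hp : 3 < p) {lam : K} (h1 : lam ≠ -1) (h2 : lam ≠ -2) :
    Module.finrank K (extSpace K p (-1) (trivRho K) (vermaRho K p 0 lam)) = 0 := by
  have : Subsingleton (extSpace K p (-1) (trivRho K) (vermaRho K p 0 lam)) := by
    refine Submodule.Quotient.subsingleton_iff.2 (eq_top_iff.2 ?_)
    rintro ⟨c, hc⟩ -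
    rw [Submodule.mem_comap]
    refine mem_coboundaries_of_highest_eq_zero hp hc ?_ ?_
    · refine (mul_eq_zero.1 (cocycle_weight hc (j := 1) (by omega) (by omega))).resolve_left ?_
      exact fun h => h1 (by push_cast at h; linear_combination h)
    · refine (mul_eq_zero.1 (cocycle_weight hc (j := 2) (by omega) (by omega))).resolve_left ?_
      exact fun h => h2 (by push_cast at h; linear_combination h)
  exact Module.finrank_zero_of_subsingleton

end Cocycles

open scoped Classical in
/-- For `χ = 0` and `λ ∈ F_p`, in the category of restricted `W`-modules,
`Ext(V_0(λ), K) ≅ K` if `λ ∈ {p-1, p-2}` and `Ext(V_0(λ), K) = 0` otherwise. -/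
theorem ext_verma_trivial
    (K : Type) [Field K] [IsAlgClosed K] (p : ℕ) [CharP K p] (hp : 3 < p)
    (lam : K) (hlam : lam ^ p = lam) :
    Module.finrank K (extSpace K p (-1) (trivRho K) (vermaRho K p 0 lam))
      = if lam = (p : K) - 1 ∨ lam = (p : K) - 2 then 1 else 0 := by
  rw [CharP.cast_eq_zero, zero_sub, zero_sub]
  split_ifs with h
  · rcases h with rfl | rfl
    · exact finrank_extSpace_of_weight hp (Or.inl rfl) (by rw [Nat.cast_one])
    · exact finrank_extSpace_of_weight hp (Or.inr rfl) (by rw [Nat.cast_ofNat])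
  · rw [not_or] at h
    exact finrank_extSpace_of_ne hp h.1 h.2
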